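/- Equality of optimal values: if d_H ≥ rank(X), then the siamese problem achieves the same optimal value as the unconstrained EDSC problem: inf_{W ∈ ℝ^{d_H×d_X}} g(W) = min_{C ∈ ℝ^{N×N}} f(C), and the infimum on the left is attained. -/

import Mathlib

open Matrix BigOperators

/-- Squared Frobenius norm of a real matrix. -/
noncomputable def frobSq {m n : ℕ} (M : Matrix (Fin m) (Fin n) ℝ) : ℝ :=
  ∑ i, ∑ j, (M i j) ^ 2

/-- EDSC objective `f(C) = (1/2)‖C‖_F² + (λ/2)‖X − XC‖_F²`. -/
noncomputable def edsc {dX N : ℕ} (X : Matrix (Fin dX) (Fin N) ℝ) (lam : ℝ)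
    (C : Matrix (Fin N) (Fin N) ℝ) : ℝ :=
  (1 / 2) * frobSq C + (lam / 2) * frobSq (X - X * C)

/-- Siamese objective `g(W) = f(XᵀWᵀWX)`. -/
noncomputable def siam {dX N dH : ℕ} (X : Matrix (Fin dX) (Fin N) ℝ) (lam : ℝ)
    (W : Matrix (Fin dH) (Fin dX) ℝ) : ℝ :=
  edsc X lam (Xᵀ * Wᵀ * W * X)

theorem frobSq_eq_trace {m n : ℕ} (M : Matrix (Fin m) (Fin n) ℝ) :
    frobSq M = (Mᵀ * M).trace := by
  simp only [frobSq, Matrix.trace, Matrix.diag, Matrix.mul_apply, Matrix.transpose_apply]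
  rw [Finset.sum_comm]
  simp only [sq]

theorem frobSq_nonneg {m n : ℕ} (M : Matrix (Fin m) (Fin n) ℝ) : 0 ≤ frobSq M :=
  Finset.sum_nonneg fun _ _ => Finset.sum_nonneg fun _ _ => sq_nonneg _

theorem frobSq_add {m n : ℕ} (A B : Matrix (Fin m) (Fin n) ℝ) :
    frobSq (A + B) = frobSq A + 2 * (Aᵀ * B).trace + frobSq B := by
  have h : (Bᵀ * A).trace = (Aᵀ * B).trace := by
    rw [← Matrix.trace_transpose, Matrix.transpose_mul, Matrix.transpose_transpose]
  simp only [frobSq_eq_trace, Matrix.transpose_add, Matrix.add_mul, Matrix.mul_add,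
    Matrix.trace_add, h]
  ring

/-- A critical point of the convex EDSC objective is a global minimizer. -/
theorem edsc_le_of_stationary {dX N : ℕ} (X : Matrix (Fin dX) (Fin N) ℝ) {lam : ℝ}
    (hlam : 0 ≤ lam) {C : Matrix (Fin N) (Fin N) ℝ} (hC : C = lam • (Xᵀ * (X - X * C)))
    (C' : Matrix (Fin N) (Fin N) ℝ) : edsc X lam C ≤ edsc X lam C' := by
  obtain ⟨D, rfl⟩ : ∃ D, C' = C + D := ⟨C' - C, by abel⟩
  have hres : X - X * (C + D) = (X - X * C) + -(X * D) := by
    rw [Matrix.mul_add]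
    abel
  have hcross : (Cᵀ * D).trace = lam * ((X - X * C)ᵀ * (X * D)).trace := by
    conv_lhs => rw [hC]
    rw [Matrix.transpose_smul, Matrix.transpose_mul, Matrix.transpose_transpose,
      Matrix.smul_mul, Matrix.trace_smul, Matrix.mul_assoc, smul_eq_mul]
  have h₁ := frobSq_nonneg D
  have h₂ := mul_nonneg hlam (frobSq_nonneg (-(X * D)))
  simp only [edsc, hres, frobSq_add, hcross, Matrix.mul_neg, Matrix.trace_neg]
  linarith

/-- A matrix of rank at most `d` can be compressed to `d` rows without changing its
Gram matrix. -/
theorem exists_mul_gram_eq_of_rank_le {m n d : ℕ} (Y : Matrix (Fin m) (Fin n) ℝ)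
    (hd : Y.rank ≤ d) :
    ∃ U : Matrix (Fin d) (Fin m) ℝ, (U * Y)ᵀ * (U * Y) = Yᵀ * Y := by
  let y : Fin n → EuclideanSpace ℝ (Fin m) := fun k => WithLp.toLp 2 (Y.col k)
  let V : Submodule ℝ (EuclideanSpace ℝ (Fin m)) := Submodule.span ℝ (Set.range y)
  have hy (k : Fin n) : y k ∈ V := Submodule.subset_span ⟨k, rfl⟩
  have hV : Module.finrank ℝ V = Y.rank := by
    rw [Matrix.rank_eq_finrank_span_cols,
      ← LinearEquiv.finrank_map_eq (WithLp.linearEquiv 2 ℝ (Fin m → ℝ)) V,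
      Submodule.map_span, ← Set.range_comp]
    rfl
  obtain ⟨e, rfl⟩ := Nat.exists_eq_add_of_le (hV.trans_le hd)
  let b := stdOrthonormalBasis ℝ V
  let U : Matrix (Fin (Module.finrank ℝ V + e)) (Fin m) ℝ :=
    Matrix.of (Fin.append (fun i j => (b i : EuclideanSpace ℝ (Fin m)) j) 0)
  have hU (i : Fin (Module.finrank ℝ V)) (k : Fin n) :
      (U * Y) (Fin.castAdd e i) k = inner ℝ (b i) (⟨y k, hy k⟩ : V) := by
    simp [U, y, Matrix.mul_apply, PiLp.inner_apply, mul_comm]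
  have hU₀ (i : Fin e) (k : Fin n) : (U * Y) (Fin.natAdd _ i) k = 0 := by
    simp [U, Matrix.mul_apply]
  refine ⟨U, ?_⟩
  ext k l
  have hsum := b.sum_inner_mul_inner ⟨y k, hy k⟩ ⟨y l, hy l⟩
  rw [Matrix.mul_apply, Fin.sum_univ_add]
  simp only [Matrix.transpose_apply, hU, hU₀, mul_zero, Finset.sum_const_zero, add_zero]
  simp only [real_inner_comm (b _) (⟨y k, hy k⟩ : V)] at hsum ⊢
  rw [hsum]
  simp [y, Matrix.mul_apply, PiLp.inner_apply, mul_comm]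

/-- Equality of optimal values: if `d_H ≥ rank X`, the siamese problem attains the
same optimal value as the unconstrained EDSC problem; both minima are attained. -/
theorem siamese_edsc_equal_optimal_values {dX N dH : ℕ}
    (X : Matrix (Fin dX) (Fin N) ℝ) (lam : ℝ) (hlam : 0 < lam)
    (hdH : X.rank ≤ dH) :
    ∃ (W : Matrix (Fin dH) (Fin dX) ℝ) (C : Matrix (Fin N) (Fin N) ℝ),
      siam X lam W = edsc X lam C ∧
      (∀ W' : Matrix (Fin dH) (Fin dX) ℝ, siam X lam W ≤ siam X lam W') ∧
      (∀ C' : Matrix (Fin N) (Fin N) ℝ, edsc X lam C ≤ edsc X lam C') := by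
  set A : Matrix (Fin dX) (Fin dX) ℝ := 1 + lam • (X * Xᵀ) with hA
  have hApos : A.PosDef := by
    have hX : (X * Xᵀ).PosSemidef := by
      simpa using Matrix.posSemidef_self_mul_conjTranspose X
    exact Matrix.PosDef.one.add_posSemidef (hX.smul hlam.le)
  have hinv : A * A⁻¹ = 1 := Matrix.mul_nonsing_inv A hApos.det_pos.ne'.isUnit
  obtain ⟨S, hS⟩ : ∃ S : Matrix (Fin dX) (Fin dX) ℝ, lam • A⁻¹ = Sᵀ * S := by
    open scoped MatrixOrder Matrix.Norms.L2Operator in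
    obtain ⟨S, hS⟩ := CStarAlgebra.nonneg_iff_eq_star_mul_self.mp
      (hApos.inv.posSemidef.smul hlam.le).nonneg
    exact ⟨S, by simpa [Matrix.star_eq_conjTranspose] using hS⟩
  obtain ⟨U, hU⟩ := exists_mul_gram_eq_of_rank_le (S * X)
    ((Matrix.rank_mul_le_right S X).trans hdH)
  have hQ : Xᵀ * (U * S)ᵀ * (U * S) * X = Xᵀ * (lam • A⁻¹) * X := by
    rw [hS]
    simpa only [Matrix.transpose_mul, Matrix.mul_assoc] using hU
  set C := Xᵀ * (U * S)ᵀ * (U * S) * X with hC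
  have hstat : C = lam • (Xᵀ * (X - X * C)) := by
    have h : C + lam • (Xᵀ * (X * C)) = lam • (Xᵀ * X) := by
      calc C + lam • (Xᵀ * (X * C)) = lam • (Xᵀ * (A * A⁻¹) * X) := by
            rw [hQ, hA]
            simp only [Matrix.add_mul, Matrix.mul_add, Matrix.one_mul, Matrix.smul_mul,
              Matrix.mul_smul, smul_add, Matrix.mul_assoc]
        _ = lam • (Xᵀ * X) := by rw [hinv, Matrix.mul_one]
    rw [Matrix.mul_sub, smul_sub]
    exact eq_sub_of_add_eq h
  have hmin := edsc_le_of_stationary X hlam.le hstat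
  exact ⟨U * S, C, rfl, fun _ => hmin _, hmin⟩
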